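/- arXiv:1904.11364 — 3 statements merged into one kernel-verified Lean document; each statement's English description precedes it below -/
import Mathlib

section
/- Let t0 ≥ 0 and let g : [t0, ∞) → ℝ be a nonnegative differentiable function satisfying the differential inequality g'(t) ≤ -γ(t)·g(t) + α(t, g(t)) + β(t) for all t ≥ t0, where γ and β are continuous real-valued functions on [t0, ∞), and α : [t0, ∞) × [0, ∞) → ℝ is continuous, nonnegative, and nondecreasing in its second argument. Suppose there exists a positive continuously differentiable function μ : [t0, ∞) → ℝ such that α(t, 1/μ(t)) + β(t) ≤ (1/μ(t))·(γ(t) - μ'(t)/μ(t)) for all t ≥ t0, and such that μ(t0)·g(t0) < 1. Then 0 ≤ g(t) < 1/μ(t) for all t ≥ t0. -/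
/-- A function with `h' ≥ -C h` on `(a, b)` and `h a > 0` is positive at `b`. -/
theorem pos_of_neg_mul_le_hasDerivAt {h h' : ℝ → ℝ} {a b C : ℝ} (hab : a ≤ b)
    (hcont : ContinuousOn h (Set.Icc a b))
    (hderiv : ∀ s ∈ Set.Ioo a b, HasDerivAt h (h' s) s)
    (hle : ∀ s ∈ Set.Ioo a b, -C * h s ≤ h' s) (ha : 0 < h a) : 0 < h b := by
  have hmono : MonotoneOn (fun s => h s * Real.exp (C * s)) (Set.Icc a b) := by
    refine monotoneOn_of_hasDerivWithinAt_nonneg (convex_Icc a b)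
      (f' := fun s => h' s * Real.exp (C * s) + h s * (Real.exp (C * s) * (C * 1)))
      (hcont.mul (by fun_prop)) (fun s hs => ?_) (fun s hs => ?_)
    · rw [interior_Icc] at hs
      exact ((hderiv s hs).mul ((hasDerivAt_id s).const_mul C).exp).hasDerivWithinAt
    · rw [interior_Icc] at hs
      have hnonneg : 0 ≤ (h' s + C * h s) * Real.exp (C * s) :=
        mul_nonneg (by linarith [hle s hs]) (Real.exp_pos _).le
      linarith
  have hexp := hmono (Set.left_mem_Icc.2 hab) (Set.right_mem_Icc.2 hab) hab
  exact pos_of_mul_pos_left ((mul_pos ha (Real.exp_pos _)).trans_le hexp) (Real.exp_pos _).le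

/-- A function that is positive at `a`, and at every `b ≥ a` such that it is positive on
`[a, b)`, is positive on `[a, ∞)`. -/
theorem ContinuousOn.pos_of_forall_Ico_pos {h : ℝ → ℝ} {a : ℝ}
    (hcont : ContinuousOn h (Set.Ici a))
    (hstep : ∀ b, a ≤ b → (∀ s ∈ Set.Ico a b, 0 < h s) → 0 < h b) :
    ∀ t, a ≤ t → 0 < h t := by
  intro t ht
  by_contra! hneg
  have hclosed : IsClosed (Set.Icc a t ∩ h ⁻¹' Set.Iic 0) :=
    (hcont.mono Set.Icc_subset_Ici_self).preimage_isClosed_of_isClosed isClosed_Icc isClosed_Iic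
  obtain ⟨b, ⟨hb, hhb⟩, hleast⟩ :=
    (isCompact_Icc.of_isClosed_subset hclosed Set.inter_subset_left).exists_isLeast
      ⟨t, ⟨ht, le_rfl⟩, hneg⟩
  refine (hstep b hb.1 fun s hs => ?_).not_ge hhb
  by_contra! hs0
  exact (hleast ⟨⟨hs.1, hs.2.le.trans hb.2⟩, hs0⟩).not_gt hs.2

/-- Lemma 1 (strict version): the nonlinear differential inequality
`g' ≤ -γ g + α(t, g) + β` on `[t0, ∞)`.  If there is a positive `C¹` function `μ`
with `α(t, 1/μ(t)) + β(t) ≤ (1/μ(t)) (γ(t) - μ'(t)/μ(t))` for all `t ≥ t0` and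
`μ(t0) g(t0) < 1`, then `0 ≤ g(t) < 1/μ(t)` for all `t ≥ t0`. -/
theorem global_bound_of_nonlinear_inequality_strict
    (t0 : ℝ) (ht0 : 0 ≤ t0)
    (g γ β μ : ℝ → ℝ) (α : ℝ → ℝ → ℝ)
    (hg_diff : ∀ t, t0 ≤ t → DifferentiableWithinAt ℝ g (Set.Ici t0) t)
    (hg_nonneg : ∀ t, t0 ≤ t → 0 ≤ g t)
    (hγ : ContinuousOn γ (Set.Ici t0))
    (hβ : ContinuousOn β (Set.Ici t0))
    (hα_cont : ContinuousOn (fun p : ℝ × ℝ => α p.1 p.2)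
      ((Set.Ici t0) ×ˢ (Set.Ici (0 : ℝ))))
    (hα_nonneg : ∀ t y, t0 ≤ t → 0 ≤ y → 0 ≤ α t y)
    (hα_mono : ∀ t, t0 ≤ t → ∀ y z, 0 ≤ y → y ≤ z → α t y ≤ α t z)
    (hineq : ∀ t, t0 ≤ t →
      derivWithin g (Set.Ici t0) t ≤ -γ t * g t + α t (g t) + β t)
    (hμ_pos : ∀ t, t0 ≤ t → 0 < μ t)
    (hμ_diff : ∀ t, t0 ≤ t → DifferentiableWithinAt ℝ μ (Set.Ici t0) t)
    (hμ'_cont : ContinuousOn (derivWithin μ (Set.Ici t0)) (Set.Ici t0))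
    (hcond : ∀ t, t0 ≤ t →
      α t (1 / μ t) + β t ≤
        (1 / μ t) * (γ t - derivWithin μ (Set.Ici t0) t / μ t))
    (hinit : μ t0 * g t0 < 1) :
    ∀ t, t0 ≤ t → 0 ≤ g t ∧ g t < 1 / μ t := by
  have hg_cont : ContinuousOn g (Set.Ici t0) := fun t ht => (hg_diff t ht).continuousWithinAt
  have hμ_cont : ContinuousOn μ (Set.Ici t0) := fun t ht => (hμ_diff t ht).continuousWithinAt
  have hcont : ContinuousOn (fun t => (μ t)⁻¹ - g t) (Set.Ici t0) :=
    (hμ_cont.inv₀ fun t ht => (hμ_pos t ht).ne').sub hg_cont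
  have hinit' : 0 < (μ t0)⁻¹ - g t0 := by
    rw [sub_pos, ← one_div, lt_div_iff₀ (hμ_pos t0 le_rfl), mul_comm]
    exact hinit
  have hpos : ∀ t, t0 ≤ t → 0 < (μ t)⁻¹ - g t := by
    refine hcont.pos_of_forall_Ico_pos fun b hb hlt => ?_
    obtain ⟨C, hC⟩ := isCompact_Icc.bddAbove_image
      (hγ.mono (Set.Icc_subset_Ici_self : Set.Icc t0 b ⊆ Set.Ici t0))
    refine pos_of_neg_mul_le_hasDerivAt (C := C) (h := fun s => (μ s)⁻¹ - g s)
      (h' := fun s => -derivWithin μ (Set.Ici t0) s / μ s ^ 2 - derivWithin g (Set.Ici t0) s)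
      hb (hcont.mono Set.Icc_subset_Ici_self) (fun s hs => ?_) (fun s hs => ?_) hinit'
    · have hnhds : Set.Ici t0 ∈ nhds s := Ici_mem_nhds hs.1
      exact (((hμ_diff s hs.1.le).hasDerivWithinAt.hasDerivAt hnhds).fun_inv
        (hμ_pos s hs.1.le).ne').sub ((hg_diff s hs.1.le).hasDerivWithinAt.hasDerivAt hnhds)
    · have hs0 : t0 ≤ s := hs.1.le
      have hgap := hlt s ⟨hs0, hs.2⟩
      have hγC : γ s ≤ C := hC ⟨s, ⟨hs0, hs.2.le⟩, rfl⟩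
      have hα := hα_mono s hs0 (g s) (μ s)⁻¹ (hg_nonneg s hs0) (by linarith)
      have hμs := hcond s hs0
      rw [one_div] at hμs
      have hdiv : (μ s)⁻¹ * (γ s - derivWithin μ (Set.Ici t0) s / μ s) =
          (μ s)⁻¹ * γ s + -derivWithin μ (Set.Ici t0) s / μ s ^ 2 := by
        have := (hμ_pos s hs0).ne'
        field_simp
        ring
      have hCgap := mul_le_mul_of_nonneg_right hγC hgap.le
      linarith [hineq s hs0]
  intro t ht
  refine ⟨hg_nonneg t ht, ?_⟩
  rw [one_div]
  exact sub_pos.1 (hpos t ht)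
end

section
/- Let c₀, c₁, c₂, b₀, b₁, b, p, q be positive constants and let c₃ > 0 satisfy c₃ < 1/c₀ and, for all t ≥ 0, c₀ e^{−b₀ t} + c₁ e^{−b₁ t} + c₂ e^{−b t} + (c₁ e^{−b₁ t} + c₂ e^{−b t})(c₃ e^{−q t})^{−2p} ≤ q c₃^{−1} e^{q t}. Let g : [0, ∞) → ℝ be a nonnegative differentiable function with g(0) ≤ c₀ satisfying g'(t) ≤ c₀ e^{−b₀ t} + c₁ e^{−b₁ t}(1 + g(t)^{2p}) + c₂ e^{−b t}(1 + g(t)^{2p}) for all t ≥ 0. Then g(t) < e^{q t}/c₃ for all t ≥ 0. -/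
open Real

/-- A function that starts positive, and is nondecreasing as long as it stays positive,
stays positive. -/
lemma pos_of_deriv_nonneg_while_pos {h : ℝ → ℝ} (hcont : ContinuousOn h (Set.Ici 0))
    (hdiff : ∀ t, 0 < t → DifferentiableAt ℝ h t) (h0 : 0 < h 0)
    (hderiv : ∀ t, 0 < t → 0 < h t → 0 ≤ deriv h t) :
    ∀ t, 0 ≤ t → 0 < h t := by
  intro t ht
  by_contra! hneg
  have hclosed : IsClosed (Set.Icc 0 t ∩ h ⁻¹' Set.Iic 0) :=
    (hcont.mono Set.Icc_subset_Ici_self).preimage_isClosed_of_isClosed isClosed_Icc isClosed_Iic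
  have hcompact : IsCompact (Set.Icc 0 t ∩ h ⁻¹' Set.Iic 0) :=
    isCompact_Icc.of_isClosed_subset hclosed Set.inter_subset_left
  obtain ⟨T, ⟨⟨hT0, hTt⟩, hT⟩, hleast⟩ := hcompact.exists_isLeast ⟨t, ⟨ht, le_rfl⟩, hneg⟩
  have hpos : ∀ s ∈ Set.Ioo 0 T, 0 < h s := by
    intro s hs
    by_contra! hs'
    exact absurd (hleast ⟨⟨hs.1.le, hs.2.le.trans hTt⟩, hs'⟩) (not_le.mpr hs.2)
  have hmono : MonotoneOn h (Set.Icc 0 T) := by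
    refine monotoneOn_of_deriv_nonneg (convex_Icc 0 T) (hcont.mono Set.Icc_subset_Ici_self) ?_ ?_
    · rw [interior_Icc]
      exact fun s hs => (hdiff s hs.1).differentiableWithinAt
    · rw [interior_Icc]
      exact fun s hs => hderiv s hs.1 (hpos s hs)
  have hle := hmono ⟨le_rfl, hT0⟩ ⟨hT0, le_rfl⟩ hT0
  exact absurd (h0.trans_le hle) (not_lt.mpr hT)

/-- Application of Lemma 1 with `γ ≡ 0` and `μ(t) = c₃ e^{-q t}`: if `c₃ > 0`
satisfies `c₃ < 1/c₀` and the inequality (15) for all `t ≥ 0`, and if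
`g : [0, ∞) → ℝ` is nonnegative, differentiable, with `g(0) ≤ c₀` and
`g'(t) ≤ c₀ e^{-b₀ t} + c₁ e^{-b₁ t}(1 + g(t)^{2p}) + c₂ e^{-b t}(1 + g(t)^{2p})`,
then `g(t) < e^{q t}/c₃` for all `t ≥ 0`. -/
theorem exponential_growth_bound
    (c₀ c₁ c₂ b₀ b₁ b p q c₃ : ℝ)
    (hc₀ : 0 < c₀) (hc₁ : 0 < c₁) (hc₂ : 0 < c₂)
    (hb₀ : 0 < b₀) (hb₁ : 0 < b₁) (hb : 0 < b) (hp : 0 < p) (hq : 0 < q)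
    (hc₃ : 0 < c₃) (hc₃c₀ : c₃ < 1 / c₀)
    (hcond : ∀ t : ℝ, 0 ≤ t →
      c₀ * exp (-b₀ * t) + c₁ * exp (-b₁ * t) + c₂ * exp (-b * t) +
          (c₁ * exp (-b₁ * t) + c₂ * exp (-b * t)) *
            (c₃ * exp (-q * t)) ^ (-(2 * p))
        ≤ q * c₃⁻¹ * exp (q * t))
    (g : ℝ → ℝ)
    (hg_diff : ∀ t, 0 ≤ t → DifferentiableWithinAt ℝ g (Set.Ici 0) t)
    (hg_nonneg : ∀ t, 0 ≤ t → 0 ≤ g t)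
    (hg0 : g 0 ≤ c₀)
    (hineq : ∀ t, 0 ≤ t →
      derivWithin g (Set.Ici 0) t ≤
        c₀ * exp (-b₀ * t) + c₁ * exp (-b₁ * t) * (1 + g t ^ (2 * p)) +
          c₂ * exp (-b * t) * (1 + g t ^ (2 * p))) :
    ∀ t, 0 ≤ t → g t < exp (q * t) / c₃ := by
  have hgAt : ∀ t, 0 < t → DifferentiableAt ℝ g t := fun t ht =>
    (hg_diff t ht.le).differentiableAt (Ici_mem_nhds ht)
  have hbarrier : ∀ t, HasDerivAt (fun s => exp (q * s) / c₃) (q * c₃⁻¹ * exp (q * t)) t := by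
    intro t
    have hlin : HasDerivAt (fun s : ℝ => q * s) q t := by
      simpa using (hasDerivAt_id t).const_mul q
    exact (hlin.exp.div_const c₃).congr_deriv (by ring)
  have hbarrier_rpow : ∀ t, (c₃ * exp (-q * t)) ^ (-(2 * p)) = (exp (q * t) / c₃) ^ (2 * p) := by
    intro t
    have hinv : c₃ * exp (-q * t) = (exp (q * t) / c₃)⁻¹ := by
      rw [neg_mul, exp_neg, inv_div, div_eq_mul_inv]
    rw [hinv, rpow_neg (by positivity), inv_rpow (by positivity), inv_inv]
  intro t ht
  refine sub_pos.mp (pos_of_deriv_nonneg_while_pos (h := fun s => exp (q * s) / c₃ - g s)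
    ?_ ?_ ?_ ?_ t ht)
  · exact ContinuousOn.sub (fun s _ => (hbarrier s).continuousAt.continuousWithinAt)
      fun s hs => (hg_diff s hs).continuousWithinAt
  · exact fun s hs => (hbarrier s).differentiableAt.sub (hgAt s hs)
  · have hlt : c₀ < 1 / c₃ := (lt_one_div hc₃ hc₀).mp hc₃c₀
    simpa using hg0.trans_lt (by simpa using hlt)
  · intro s hs hpos
    have hderiv : deriv (fun s => exp (q * s) / c₃ - g s) s
        = q * c₃⁻¹ * exp (q * s) - deriv g s :=
      ((hbarrier s).sub (hgAt s hs).hasDerivAt).deriv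
    have hpow : g s ^ (2 * p) ≤ (exp (q * s) / c₃) ^ (2 * p) :=
      rpow_le_rpow (hg_nonneg s hs.le) (sub_pos.mp hpos).le (by positivity)
    have hg' := hineq s hs.le
    rw [derivWithin_of_mem_nhds (Ici_mem_nhds hs)] at hg'
    have hcond' := hcond s hs.le
    rw [hbarrier_rpow] at hcond'
    have hmul := mul_le_mul_of_nonneg_left hpow
      (by positivity : 0 ≤ c₁ * exp (-b₁ * s) + c₂ * exp (-b * s))
    rw [hderiv]
    linarith
end

section
/- Let t0 ≥ 0 and let g : [t0, ∞) → ℝ be a nonnegative differentiable function satisfying g'(t) ≤ α(t, g(t)) + β(t) for all t ≥ t0, where β is continuous on [t0, ∞) and α : [t0, ∞) × [0, ∞) → ℝ is continuous, nonnegative, and nondecreasing in its second argument. Let r > 0 and c₄ > 0 be constants such that α(t, (1+t)^r/c₄) + β(t) ≤ ((1+t)^r/c₄)·(r/(1+t)) for all t ≥ t0, and such that c₄(1+t0)^{−r} g(t0) < 1. Then g(t) < (1+t)^r/c₄ for all t ≥ t0. -/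
/-- A function that starts negative and whose right derivative is nonpositive wherever it is
negative stays negative. -/
theorem neg_of_hasDerivWithinAt_nonpos_of_neg {a : ℝ} {f f' : ℝ → ℝ}
    (hf : ∀ t, a ≤ t → HasDerivWithinAt f (f' t) (Set.Ici a) t)
    (hf' : ∀ t, a ≤ t → f t < 0 → f' t ≤ 0) (ha : f a < 0) {t : ℝ} (hat : a ≤ t) :
    f t < 0 := by
  obtain ⟨ε, hε, hεt⟩ : ∃ ε > 0, (t - a) * ε < -f a := by
    obtain ⟨ε, hε, h⟩ := exists_pos_mul_lt (neg_pos.2 ha) (t - a)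
    exact ⟨ε, hε, h⟩
  have hB : ∀ x ∈ Set.Icc a t, f a + ε * (x - a) < 0 := fun x hx ↦ by
    nlinarith [mul_le_mul_of_nonneg_left hx.2 hε.le]
  have hle : f t ≤ f a + ε * (t - a) :=
    image_le_of_deriv_right_lt_deriv_boundary (f' := f') (B' := fun _ ↦ ε)
      (fun x hx ↦ (hf x hx.1).continuousWithinAt.mono Set.Icc_subset_Ici_self)
      (fun x hx ↦ (hf x hx.1).mono (Set.Ici_subset_Ici.2 hx.1))
      (by simp)
      (fun x ↦ by simpa using (((hasDerivAt_id x).sub_const a).const_mul ε).const_add (f a))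
      (fun x hx hxB ↦ (hf' x hx.1 (hxB ▸ hB x ⟨hx.1, hx.2.le⟩)).trans_lt hε)
      (Set.right_mem_Icc.2 hat)
  exact hle.trans_lt (hB t (Set.right_mem_Icc.2 hat))


/-- Remark 2 (power-decay instantiation of Lemma 1, with `γ ≡ 0` and
`μ(t) = c₄ (1 + t)^{-r}`): if `g' ≤ α(t, g) + β` on `[t0, ∞)`,
`α(t, (1+t)^r/c₄) + β(t) ≤ ((1+t)^r/c₄) · (r/(1+t))` for all `t ≥ t0`, and
`c₄ (1+t0)^{-r} g(t0) < 1`, then `g(t) < (1+t)^r/c₄` for all `t ≥ t0`. -/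
theorem polynomial_growth_bound
    (t0 : ℝ) (ht0 : 0 ≤ t0)
    (g β : ℝ → ℝ) (α : ℝ → ℝ → ℝ) (r c₄ : ℝ)
    (hr : 0 < r) (hc₄ : 0 < c₄)
    (hg_diff : ∀ t, t0 ≤ t → DifferentiableWithinAt ℝ g (Set.Ici t0) t)
    (hg_nonneg : ∀ t, t0 ≤ t → 0 ≤ g t)
    (hβ : ContinuousOn β (Set.Ici t0))
    (hα_cont : ContinuousOn (fun p : ℝ × ℝ => α p.1 p.2)
      ((Set.Ici t0) ×ˢ (Set.Ici (0 : ℝ))))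
    (hα_nonneg : ∀ t y, t0 ≤ t → 0 ≤ y → 0 ≤ α t y)
    (hα_mono : ∀ t, t0 ≤ t → ∀ y z, 0 ≤ y → y ≤ z → α t y ≤ α t z)
    (hineq : ∀ t, t0 ≤ t →
      derivWithin g (Set.Ici t0) t ≤ α t (g t) + β t)
    (hcond : ∀ t, t0 ≤ t →
      α t ((1 + t) ^ r / c₄) + β t ≤ ((1 + t) ^ r / c₄) * (r / (1 + t)))
    (hinit : c₄ * (1 + t0) ^ (-r) * g t0 < 1) :
    ∀ t, t0 ≤ t → g t < (1 + t) ^ r / c₄ := by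
  intro t ht
  have hw : ∀ x, t0 ≤ x → HasDerivAt (fun x ↦ (1 + x) ^ r / c₄)
      ((1 + x) ^ r / c₄ * (r / (1 + x))) x := fun x hx ↦ by
    have hx1 : 0 < 1 + x := by linarith
    refine ((((hasDerivAt_id' x).const_add 1).rpow_const (p := r)
      (Or.inl hx1.ne')).div_const c₄).congr_deriv ?_
    rw [Real.rpow_sub_one hx1.ne']
    ring
  refine sub_neg.1 (neg_of_hasDerivWithinAt_nonpos_of_neg
    (fun x hx ↦ (hg_diff x hx).hasDerivWithinAt.sub (hw x hx).hasDerivWithinAt)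
    (fun x hx hneg ↦ ?_) ?_ ht)
  · have hα := hα_mono x hx (g x) _ (hg_nonneg x hx) (sub_neg.1 hneg).le
    linarith [hineq x hx, hcond x hx]
  · have h1 : 0 < 1 + t0 := by linarith
    have hp : 0 < (1 + t0) ^ r := Real.rpow_pos_of_pos h1 r
    refine sub_neg.2 ((lt_div_iff₀ hc₄).2 ?_)
    rw [Real.rpow_neg h1.le, mul_right_comm, ← div_eq_mul_inv, div_lt_one hp] at hinit
    rwa [mul_comm]
end
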